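/- arXiv:1704.00657 — 4 statements merged into one kernel-verified Lean document; each statement's English description precedes it below -/
import Mathlib

section
/- If f is in the class T of typically real functions on the unit disk with Taylor expansion f(z) = z + ∑_{k≥2} a_k z^k (so that all coefficients a_k are real), then for every integer n ≥ 2 the second-order symmetric Toeplitz determinant satisfies −(n+1)² ≤ T_2(n) = a_n² − a_{n+1}² ≤ n². -/
/-- `f` is a typically real function on the unit disk with (real) Taylor
coefficients `a`: it is analytic on the disk, normalized by `a 0 = 0`,
`a 1 = 1`, has power series expansion `f z = ∑ a n * z ^ n` on the disk,
and satisfies `(Im z) * (Im (f z)) ≥ 0` there. -/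
def IsTypicallyReal (f : ℂ → ℂ) (a : ℕ → ℝ) : Prop :=
  DifferentiableOn ℂ f (Metric.ball (0:ℂ) 1) ∧
  a 0 = 0 ∧ a 1 = 1 ∧
  (∀ z ∈ Metric.ball (0:ℂ) 1, HasSum (fun n : ℕ => (a n : ℂ) * z ^ n) (f z)) ∧
  ∀ z ∈ Metric.ball (0:ℂ) 1, 0 ≤ z.im * (f z).im

lemma tr_abs_sin (n : ℕ) (x : ℝ) : |Real.sin (n * x)| ≤ n * |Real.sin x| := by
  induction n with
  | zero => simp
  | succ k ih =>
    have h : Real.sin (((k + 1 : ℕ) : ℝ) * x)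
        = Real.sin (k * x) * Real.cos x + Real.cos (k * x) * Real.sin x := by
      rw [← Real.sin_add]; congr 1; push_cast; ring
    rw [h]
    refine (abs_add_le _ _).trans ?_
    rw [abs_mul, abs_mul]
    have h1 := mul_le_of_le_one_right (abs_nonneg (Real.sin (k * x))) (Real.abs_cos_le_one x)
    have h2 := mul_le_of_le_one_left (abs_nonneg (Real.sin x)) (Real.abs_cos_le_one (k * x))
    push_cast
    linarith

lemma tr_int_cos (m : ℤ) :
    ∫ x in (0:ℝ)..(2 * Real.pi), Real.cos (m * x) = if m = 0 then 2 * Real.pi else 0 := by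
  split_ifs with h
  · simp [h]
  · have hm : (m : ℝ) ≠ 0 := by exact_mod_cast h
    rw [intervalIntegral.integral_comp_mul_left (fun x => Real.cos x) hm, integral_cos]
    have h2 : Real.sin (m * (2 * Real.pi)) = 0 := by
      have := Real.sin_int_mul_pi (2 * m)
      rw [← this]; congr 1; push_cast; ring
    simp [h2]

lemma tr_int_sin (k n : ℕ) (hn : 1 ≤ n) :
    ∫ x in (0:ℝ)..(2 * Real.pi), Real.sin (k * x) * Real.sin (n * x)
      = if k = n then Real.pi else 0 := by
  have h : ∀ x : ℝ, Real.sin (k * x) * Real.sin (n * x)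
      = (Real.cos (((k - n : ℤ) : ℝ) * x) - Real.cos (((k + n : ℤ) : ℝ) * x)) / 2 := by
    intro x
    push_cast
    rw [sub_mul, add_mul, Real.cos_sub, Real.cos_add]; ring
  simp_rw [h]
  rw [intervalIntegral.integral_div, intervalIntegral.integral_sub, tr_int_cos, tr_int_cos]
  · have h1 : ((k : ℤ) + n ≠ 0) := by omega
    rw [if_neg h1]
    by_cases hk : k = n
    · simp [hk]
    · have h2 : ((k : ℤ) - n ≠ 0) := by omega
      simp [hk, h2]
  · exact Continuous.intervalIntegrable (by fun_prop) _ _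
  · exact Continuous.intervalIntegrable (by fun_prop) _ _

lemma tr_coeff (f : ℂ → ℂ) (a : ℕ → ℝ) (hT : IsTypicallyReal f a) (n : ℕ) (hn : 1 ≤ n)
    (r : ℝ) (h0 : 0 < r) (h1 : r < 1) : |a n| * r ^ n ≤ n * r := by
  obtain ⟨hd, ha0, ha1, hs, hpos⟩ := hT
  set z : ℝ → ℂ := fun x => r * Complex.exp (x * Complex.I) with hz
  have hzn : ∀ x, ‖z x‖ = r := by
    intro x; simp [hz, Complex.norm_exp_ofReal_mul_I, abs_of_pos h0]
  have hzb : ∀ x, z x ∈ Metric.ball (0:ℂ) 1 := by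
    intro x; simp [hzn, h1]
  have hzim : ∀ x, (z x).im = r * Real.sin x := by
    intro x; simp [hz, Complex.exp_ofReal_mul_I_im]
  set v : ℝ → ℝ := fun x => (f (z x)).im with hv
  have hzc : Continuous z := by fun_prop
  have hvc : Continuous v := by
    have : Continuous fun x => f (z x) := hd.continuousOn.comp_continuous hzc hzb
    exact Complex.continuous_im.comp this
  have hvs : ∀ x, HasSum (fun k : ℕ => a k * r ^ k * Real.sin (k * x)) (v x) := by
    intro x
    have := Complex.hasSum_im (hs (z x) (hzb x))
    convert this using 2 with k
    have e : (a k : ℂ) * z x ^ k = ((a k * r ^ k : ℝ) : ℂ) * Complex.exp (((k * x : ℝ) : ℂ) * Complex.I) := by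
      simp only [hz, mul_pow, ← Complex.exp_nat_mul]
      push_cast
      rw [mul_assoc]; congr 3; ring
    rw [e, Complex.im_ofReal_mul, Complex.exp_ofReal_mul_I_im]
  have hsum : Summable fun k : ℕ => |a k * r ^ k| := by
    have := (hs (z 0) (hzb 0)).summable.norm
    refine this.congr fun k => ?_
    simp [hzn, abs_mul, abs_of_pos h0]
  have hint : ∀ m : ℕ, 1 ≤ m →
      ∫ x in (0:ℝ)..(2 * Real.pi), v x * Real.sin (m * x) = Real.pi * (a m * r ^ m) := by
    intro m hm
    have H := intervalIntegral.hasSum_integral_of_dominated_convergence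
      (μ := MeasureTheory.volume) (a := 0) (b := 2 * Real.pi)
      (F := fun (k : ℕ) x => a k * r ^ k * Real.sin (k * x) * Real.sin (m * x))
      (f := fun x => v x * Real.sin (m * x))
      (fun (k : ℕ) _ => |a k * r ^ k|)
      (fun k => (Continuous.aestronglyMeasurable (by fun_prop)))
      (fun k => Filter.Eventually.of_forall fun x _ => by
        rw [Real.norm_eq_abs, abs_mul, abs_mul (a k * r ^ k)]
        have := mul_le_one₀ (Real.abs_sin_le_one (k * x)) (abs_nonneg _)
          (Real.abs_sin_le_one (m * x))
        rw [mul_assoc]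
        exact mul_le_of_le_one_right (abs_nonneg _) this)
      (Filter.Eventually.of_forall fun x _ => hsum)
      (by simp)
      (Filter.Eventually.of_forall fun x _ => (hvs x).mul_right _)
    have H2 : ∀ k : ℕ, ∫ x in (0:ℝ)..(2 * Real.pi),
        a k * r ^ k * Real.sin (k * x) * Real.sin (m * x)
          = if k = m then Real.pi * (a m * r ^ m) else 0 := by
      intro k
      simp_rw [mul_assoc (a k * r ^ k)]
      rw [intervalIntegral.integral_const_mul, tr_int_sin k m hm]
      split_ifs with hk
      · subst hk; ring
      · simp
    simp_rw [H2] at H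
    exact H.unique (hasSum_ite_eq m _)
  have hpt : ∀ x, |v x * Real.sin (n * x)| ≤ n * (v x * Real.sin ((1:ℕ) * x)) := by
    intro x
    have hp := hpos (z x) (hzb x)
    rw [hzim] at hp
    have hp2 : 0 ≤ v x * Real.sin x := by
      have : 0 ≤ r * (v x * Real.sin x) := by
        simp only [hv]; linarith
      exact nonneg_of_mul_nonneg_right this h0
    rw [Nat.cast_one, one_mul, ← abs_of_nonneg hp2, abs_mul, abs_mul]
    have := mul_le_mul_of_nonneg_left (tr_abs_sin n x) (abs_nonneg (v x))
    linarith
  have hle : |∫ x in (0:ℝ)..(2 * Real.pi), v x * Real.sin (n * x)|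
      ≤ ∫ x in (0:ℝ)..(2 * Real.pi), n * (v x * Real.sin ((1:ℕ) * x)) := by
    refine (intervalIntegral.abs_integral_le_integral_abs (by positivity)).trans ?_
    refine intervalIntegral.integral_mono_on (by positivity) ?_ ?_ (fun x _ => hpt x)
    · exact Continuous.intervalIntegrable (by fun_prop) _ _
    · exact Continuous.intervalIntegrable (by fun_prop) _ _
  rw [intervalIntegral.integral_const_mul, hint n hn, hint 1 le_rfl, ha1, abs_mul, abs_mul,
    abs_of_pos Real.pi_pos, abs_of_pos (pow_pos h0 n)] at hle
  have : Real.pi * (|a n| * r ^ n) ≤ Real.pi * (n * r) := by linarith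
  exact le_of_mul_le_mul_left this Real.pi_pos

lemma tr_bound (f : ℂ → ℂ) (a : ℕ → ℝ) (hT : IsTypicallyReal f a) (n : ℕ) (hn : 1 ≤ n) :
    |a n| ≤ n := by
  have t1 : Filter.Tendsto (fun r : ℝ => |a n| * r ^ n) (nhdsWithin 1 (Set.Iio 1))
      (nhds (|a n| * 1 ^ n)) :=
    (Continuous.tendsto (by fun_prop) 1).mono_left nhdsWithin_le_nhds
  have t2 : Filter.Tendsto (fun r : ℝ => (n : ℝ) * r) (nhdsWithin 1 (Set.Iio 1))
      (nhds ((n : ℝ) * 1)) :=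
    (Continuous.tendsto (by fun_prop) 1).mono_left nhdsWithin_le_nhds
  have := le_of_tendsto_of_tendsto t1 t2 (by
    filter_upwards [Ioo_mem_nhdsLT (show (0:ℝ) < 1 by norm_num)] with r hr
    exact tr_coeff f a hT n hn r hr.1 hr.2)
  simpa using this

theorem stmt_13 (f : ℂ → ℂ) (a : ℕ → ℝ) (hT : IsTypicallyReal f a)
    (n : ℕ) (hn : 2 ≤ n) :
    -((n : ℝ) + 1) ^ 2 ≤ a n ^ 2 - a (n + 1) ^ 2 ∧
    a n ^ 2 - a (n + 1) ^ 2 ≤ (n : ℝ) ^ 2 := by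
  have h1 := tr_bound f a hT n (by omega)
  have h2 := tr_bound f a hT (n + 1) (by omega)
  push_cast at h2
  have h3 : a n ^ 2 ≤ (n : ℝ) ^ 2 := sq_le_sq.mpr (h1.trans (le_abs_self _))
  have h4 : a (n + 1) ^ 2 ≤ ((n : ℝ) + 1) ^ 2 := sq_le_sq.mpr (h2.trans (le_abs_self _))
  constructor
  · nlinarith [sq_nonneg (a n)]
  · nlinarith [sq_nonneg (a (n + 1))]
end

section
/- If f is in the class T of typically real functions on the unit disk with Taylor expansion f(z) = z + ∑_{k≥2} a_k z^k (so that all coefficients a_k are real), then T_2(2) = a_2² − a_3² ≤ 5/4, and this bound is attained: there exists f ∈ T (namely f(z) = z/(1 − 2tz + z²) with t = √3/(2√2)) for which a_2² − a_3² = 5/4. -/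
open MeasureTheory intervalIntegral in
lemma int_cos_int (m : ℤ) : ∫ θ in (0:ℝ)..(2*Real.pi), Real.cos (m*θ) = if m = 0 then 2*Real.pi else 0 := by
  split_ifs with h
  · simp [h]
  · have hm : (m:ℝ) ≠ 0 := by exact_mod_cast h
    rw [intervalIntegral.integral_comp_mul_left (fun x => Real.cos x) hm]
    have : Real.sin ((m:ℝ) * (2*Real.pi)) = 0 := by
      have := Real.sin_int_mul_pi (2*m)
      rw [← this]; push_cast; ring_nf
    simp [integral_cos, this]

lemma int_sin_sin (n k : ℕ) (hk : 1 ≤ k) :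
    ∫ θ in (0:ℝ)..(2*Real.pi), Real.sin (n*θ) * Real.sin (k*θ) = if n = k then Real.pi else 0 := by
  have h1 : ∀ θ : ℝ, Real.sin (n*θ) * Real.sin (k*θ)
      = (1/2) * (Real.cos (((n - k : ℤ) : ℝ) * θ) - Real.cos (((n + k : ℤ):ℝ) * θ)) := by
    intro θ
    push_cast
    rw [sub_mul, add_mul, Real.cos_sub, Real.cos_add]; ring
  simp_rw [h1]
  rw [intervalIntegral.integral_const_mul, intervalIntegral.integral_sub
    ((by fun_prop : Continuous _).intervalIntegrable _ _) ((by fun_prop : Continuous _).intervalIntegrable _ _),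
    int_cos_int, int_cos_int]
  have : ((n:ℤ) + k) ≠ 0 := by omega
  by_cases h : n = k
  · subst h; simp [this]
  · have h2 : (n:ℤ) - k ≠ 0 := by omega
    simp [this, h, h2]

lemma fourier_coef (f : ℂ → ℂ) (a : ℕ → ℝ) (r : ℝ) (h0 : 0 < r) (h1 : r < 1)
    (hs : ∀ z ∈ Metric.ball (0:ℂ) 1, HasSum (fun n : ℕ => (a n : ℂ) * z ^ n) (f z)) (k : ℕ) (hk : 1 ≤ k) :
    ∫ θ in (0:ℝ)..(2*Real.pi), (f (circleMap 0 r θ)).im * Real.sin (k*θ) = Real.pi * (a k * r ^ k) := by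
  have hsum : Summable (fun n : ℕ => |a n| * r ^ n) := by
    have := (hs (r:ℂ) (by simp [abs_of_pos h0, h1])).summable.norm
    refine this.congr fun n => ?_
    simp [abs_of_pos h0]
  have hS : ∀ θ : ℝ, HasSum (fun n : ℕ => a n * r ^ n * (Real.sin (n*θ) * Real.sin (k*θ)))
      ((f (circleMap 0 r θ)).im * Real.sin (k*θ)) := by
    intro θ
    have hz := hs (circleMap 0 r θ) (by simp [abs_of_pos h0, h1])
    have := (Complex.hasSum_im hz).mul_right (Real.sin (k*θ))
    refine (congrArg (fun F => HasSum F _) (funext fun n => ?_)).mpr this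
    have : (circleMap 0 r θ)^n = ((r^n : ℝ):ℂ) * Complex.exp (((n*θ : ℝ):ℂ) * Complex.I) := by
      simp only [circleMap, zero_add, mul_pow, ← Complex.exp_nat_mul]
      push_cast; ring_nf
    rw [this, Complex.im_ofReal_mul, Complex.im_ofReal_mul, Complex.exp_ofReal_mul_I_im]; ring
  have key := intervalIntegral.hasSum_integral_of_dominated_convergence (μ := MeasureTheory.volume)
    (a := 0) (b := 2*Real.pi)
    (F := fun (n:ℕ) (θ:ℝ) => a n * r ^ n * (Real.sin (n*θ) * Real.sin (k*θ)))
    (f := fun θ => (f (circleMap 0 r θ)).im * Real.sin (k*θ))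
    (fun n _ => |a n| * r ^ n)
    (fun n => (by fun_prop : Continuous _).aestronglyMeasurable)
    (fun n => by
      refine Filter.Eventually.of_forall fun θ _ => ?_
      rw [norm_mul, norm_mul, norm_mul, Real.norm_eq_abs, Real.norm_eq_abs, Real.norm_eq_abs, Real.norm_eq_abs, abs_of_pos (pow_pos h0 n)]
      have h3 := Real.abs_sin_le_one (n*θ)
      have h4 := Real.abs_sin_le_one (k*θ)
      exact mul_le_of_le_one_right (by positivity) (mul_le_one₀ h3 (abs_nonneg _) h4))
    (Filter.Eventually.of_forall fun θ _ => hsum)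
    (by simp)
    (Filter.Eventually.of_forall fun θ _ => hS θ)
  simp_rw [intervalIntegral.integral_const_mul, int_sin_sin _ k hk] at key
  have k2 := hasSum_single (f := fun n : ℕ => a n * r ^ n * (if n = k then Real.pi else 0)) k
    (fun n hn => by simp [hn])
  rw [key.unique k2]; simp; ring

lemma ineq_r (f : ℂ → ℂ) (a : ℕ → ℝ) (h : IsTypicallyReal f a) (l r : ℝ) (h0 : 0 < r) (h1 : r < 1) :
    0 ≤ l^2 * r - 2 * l * (a 2 * r^2) + (r + a 3 * r^3) := by
  obtain ⟨hd, ha0, ha1, hs, him⟩ := h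
  have hball : ∀ θ, circleMap 0 r θ ∈ Metric.ball (0:ℂ) 1 := fun θ => by simp [abs_of_pos h0, h1]
  have hc : Continuous (fun θ : ℝ => (f (circleMap 0 r θ)).im) :=
    Complex.continuous_im.comp (hd.continuousOn.comp_continuous (continuous_circleMap 0 r) hball)
  have e1 := fourier_coef f a r h0 h1 hs 1 le_rfl
  have e2 := fourier_coef f a r h0 h1 hs 2 (by norm_num)
  have e3 := fourier_coef f a r h0 h1 hs 3 (by norm_num)
  have hi : ∀ k : ℕ, IntervalIntegrable (fun θ : ℝ => (f (circleMap 0 r θ)).im * Real.sin (k*θ))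
      MeasureTheory.volume 0 (2*Real.pi) := fun k =>
    (hc.mul (by fun_prop)).intervalIntegrable _ _
  have hpos : 0 ≤ ∫ θ in (0:ℝ)..(2*Real.pi), ((l^2+1) * ((f (circleMap 0 r θ)).im * Real.sin ((1:ℕ)*θ))
      - 2*l*((f (circleMap 0 r θ)).im * Real.sin ((2:ℕ)*θ)) + (f (circleMap 0 r θ)).im * Real.sin ((3:ℕ)*θ)) := by
    apply intervalIntegral.integral_nonneg (by positivity)
    intro θ _
    have hh := him _ (hball θ)
    have him2 : (circleMap 0 r θ).im = r * Real.sin θ := by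
      simp [circleMap, Complex.exp_ofReal_mul_I_im]
    rw [him2, mul_assoc] at hh
    have hh := nonneg_of_mul_nonneg_right hh h0
    have : ((l^2+1) * ((f (circleMap 0 r θ)).im * Real.sin ((1:ℕ)*θ))
      - 2*l*((f (circleMap 0 r θ)).im * Real.sin ((2:ℕ)*θ)) + (f (circleMap 0 r θ)).im * Real.sin ((3:ℕ)*θ))
      = (Real.sin θ * (f (circleMap 0 r θ)).im) * (l - 2 * Real.cos θ)^2 := by
      push_cast
      rw [one_mul, Real.sin_two_mul, Real.sin_three_mul]
      have : Real.sin θ ^ 3 = Real.sin θ * (1 - Real.cos θ^2) := by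
        rw [← Real.sin_sq]; ring
      rw [this]; ring
    rw [this]; positivity
  rw [intervalIntegral.integral_add (((hi 1).const_mul _).sub ((hi 2).const_mul _)) (hi 3),
    intervalIntegral.integral_sub ((hi 1).const_mul _) ((hi 2).const_mul _),
    intervalIntegral.integral_const_mul, intervalIntegral.integral_const_mul, e1, e2, e3, ha1] at hpos
  refine nonneg_of_mul_nonneg_right (a := Real.pi) ?_ Real.pi_pos
  linarith

lemma a3_ge (f : ℂ → ℂ) (a : ℕ → ℝ) (h : IsTypicallyReal f a) : a 2 ^ 2 - 1 ≤ a 3 := by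
  have hlim : Filter.Tendsto (fun r : ℝ => (a 2)^2 * r - 2 * (a 2) * (a 2 * r^2) + (r + a 3 * r^3))
      (nhdsWithin 1 (Set.Iio 1)) (nhds ((a 2)^2 * 1 - 2 * (a 2) * (a 2 * 1^2) + (1 + a 3 * 1^3))) :=
    ((by fun_prop : Continuous (fun r : ℝ => (a 2)^2 * r - 2 * (a 2) * (a 2 * r^2) + (r + a 3 * r^3))).tendsto 1).mono_left
      nhdsWithin_le_nhds
  have := ge_of_tendsto hlim (b := 0) (by
    filter_upwards [Ioo_mem_nhdsLT (show (0:ℝ) < 1 by norm_num)] with r hr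
    exact ineq_r f a h (a 2) r hr.1 hr.2)
  linarith

lemma ext_tr (t s : ℝ) (hs : 0 < s) (hts : t^2 + s^2 = 1) :
    IsTypicallyReal (fun z : ℂ => z / (1 - 2 * (t:ℂ) * z + z ^ 2)) (fun n => (((⟨t, s⟩ : ℂ))^n).im / s) := by
  set w : ℂ := ⟨t, s⟩ with hw
  have hn : ‖w‖ = 1 := by
    have : ‖w‖^2 = 1 := by rw [Complex.sq_norm, Complex.normSq_mk]; nlinarith
    nlinarith [norm_nonneg w]
  set v : ℂ := (starRingEnd ℂ) w with hv
  have hnv : ‖v‖ = 1 := by rw [hv, RCLike.norm_conj, hn]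
  have hadd : w + v = 2 * t := by rw [hv, Complex.add_conj]; simp [hw]
  have hsub : w - v = 2 * s * Complex.I := by rw [hv, Complex.sub_conj]; simp [hw]
  have hmul : w * v = 1 := by rw [hv, Complex.mul_conj, Complex.normSq_mk]; norm_cast; nlinarith
  have hD : ∀ z : ℂ, 1 - 2 * (t:ℂ) * z + z ^ 2 = (1 - w * z) * (1 - v * z) := by
    intro z; rw [← hadd]; linear_combination (-z^2) * hmul
  have hne : ∀ u : ℂ, ‖u‖ = 1 → ∀ z ∈ Metric.ball (0:ℂ) 1, 1 - u * z ≠ 0 := by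
    intro u hu z hz h
    have : ‖u * z‖ = 1 := by rw [← sub_eq_zero.mp h]; simp
    rw [norm_mul, hu, one_mul] at this
    simp at hz; linarith
  have hDne : ∀ z ∈ Metric.ball (0:ℂ) 1, 1 - 2 * (t:ℂ) * z + z ^ 2 ≠ 0 := fun z hz => by
    rw [hD]; exact mul_ne_zero (hne w hn z hz) (hne v hnv z hz)
  have hsC : (s:ℂ) ≠ 0 := by exact_mod_cast hs.ne'
  refine ⟨?_, by simp, by simp [hw, hs.ne'], ?_, ?_⟩
  · exact DifferentiableOn.div (by fun_prop) (by fun_prop) hDne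
  · intro z hz
    have hz1 : ‖z‖ < 1 := by simpa using hz
    have g1 := hasSum_geometric_of_norm_lt_one (ξ := w * z) (by rw [norm_mul, hn, one_mul]; exact hz1)
    have g2 := hasSum_geometric_of_norm_lt_one (ξ := v * z) (by rw [norm_mul, hnv, one_mul]; exact hz1)
    have g := (g1.sub g2).mul_left (1 / (2 * s * Complex.I))
    have hval : z / (1 - 2 * (t:ℂ) * z + z ^ 2)
        = 1 / (2 * s * Complex.I) * ((1 - w * z)⁻¹ - (1 - v * z)⁻¹) := by
      rw [hD]
      have n1 := hne w hn z hz
      have n2 := hne v hnv z hz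
      have : (1 - w*z)⁻¹ - (1 - v*z)⁻¹ = (2 * s * Complex.I) * z / ((1 - w * z) * (1 - v * z)) := by
        rw [← hsub, inv_sub_inv n1 n2]; ring
      rw [this]
      field_simp
    show HasSum _ (z / (1 - 2 * (t:ℂ) * z + z ^ 2))
    rw [hval]
    refine (congrArg (fun F => HasSum F _) (funext fun n => ?_)).mpr g
    have : (w^n - v^n) = 2 * ((w^n).im) * Complex.I := by
      rw [hv, ← map_pow, Complex.sub_conj]; push_cast; ring
    rw [mul_pow, mul_pow, ← sub_mul, this]
    push_cast
    field_simp
  · intro z hz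
    have hz1 : ‖z‖ < 1 := by simpa using hz
    have hq : z.re^2 + z.im^2 < 1 := by
      have : ‖z‖^2 < 1 := by nlinarith [norm_nonneg z]
      rw [Complex.sq_norm, Complex.normSq_apply] at this; nlinarith
    have hN := Complex.normSq_pos.mpr (hDne z hz)
    have : (z / (1 - 2 * (t:ℂ) * z + z ^ 2)).im = z.im * (1 - (z.re^2+z.im^2)) / Complex.normSq (1 - 2 * (t:ℂ) * z + z ^ 2) := by
      rw [Complex.div_im, ← sub_div]
      congr 1
      simp [pow_two]
      ring
    show 0 ≤ z.im * (z / (1 - 2 * (t:ℂ) * z + z ^ 2)).im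
    rw [this, ← mul_div_assoc, ← mul_assoc]
    exact div_nonneg (mul_nonneg (mul_self_nonneg _) (by linarith)) hN.le

theorem stmt_14 :
    (∀ (f : ℂ → ℂ) (a : ℕ → ℝ), IsTypicallyReal f a →
      a 2 ^ 2 - a 3 ^ 2 ≤ 5 / 4) ∧
    (∃ a : ℕ → ℝ,
      IsTypicallyReal
        (fun z : ℂ =>
          z / (1 - 2 * (↑(Real.sqrt 3 / (2 * Real.sqrt 2)) : ℂ) * z + z ^ 2)) a ∧
      a 2 ^ 2 - a 3 ^ 2 = 5 / 4) := by
  constructor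
  · intro f a h
    have h3 := a3_ge f a h
    by_cases hx : 1 ≤ a 2 ^ 2
    · nlinarith [sq_nonneg (a 2 ^ 2 - 3/2)]
    · nlinarith [sq_nonneg (a 3)]
  · have ht : (Real.sqrt 3 / (2 * Real.sqrt 2))^2 = 3/8 := by
      rw [div_pow, mul_pow, Real.sq_sqrt, Real.sq_sqrt] <;> norm_num
    have hs2 : (Real.sqrt (5/8))^2 = 5/8 := Real.sq_sqrt (by norm_num)
    have hs : 0 < Real.sqrt (5/8) := by positivity
    refine ⟨_, ext_tr _ (Real.sqrt (5/8)) hs (by rw [ht, hs2]; norm_num), ?_⟩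
    generalize Real.sqrt 3 / (2 * Real.sqrt 2) = t at *
    generalize Real.sqrt (5/8) = s at *
    have e2 : ((⟨t, s⟩ : ℂ)^2).im / s = 2 * t := by
      simp [pow_two]; field_simp; ring
    have e3 : ((⟨t, s⟩ : ℂ)^3).im / s = 3 * t^2 - s^2 := by
      simp [pow_succ]; field_simp; ring
    simp only [e2, e3, mul_pow, ht, hs2]; norm_num
end

section
/- If f is in the class T of typically real functions on the unit disk with Taylor expansion f(z) = z + ∑_{k≥2} a_k z^k (so that all coefficients a_k are real), then −7 ≤ T_2(3) = a_3² − a_4² ≤ 9, and both bounds are sharp within T. -/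
open MeasureTheory intervalIntegral in
lemma aux_int (n k : ℕ) (hk : 1 ≤ k) :
    ∫ t in (0:ℝ)..(2 * Real.pi), Real.sin (n * t) * Real.sin (k * t) =
      if n = k then Real.pi else 0 := by
  have hcos : ∀ m : ℤ, m ≠ 0 → ∫ t in (0:ℝ)..(2 * Real.pi), Real.cos (m * t) = 0 := by
    intro m hm
    have hm' : (m : ℝ) ≠ 0 := by exact_mod_cast hm
    rw [intervalIntegral.integral_comp_mul_left (fun x => Real.cos x) hm', integral_cos]
    have : Real.sin ((m : ℝ) * (2 * Real.pi)) = 0 := by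
      have := Real.sin_int_mul_pi (m * 2)
      push_cast at this
      rw [← this]; ring_nf
    simp [this]
  have hprod : ∀ t : ℝ, Real.sin (n * t) * Real.sin (k * t) =
      (1/2) * Real.cos (((n - k : ℤ) : ℝ) * t) - (1/2) * Real.cos (((n + k : ℤ) : ℝ) * t) := by
    intro t
    push_cast
    rw [sub_mul, add_mul, Real.cos_sub, Real.cos_add]; ring
  simp_rw [hprod]
  rw [intervalIntegral.integral_sub (by apply Continuous.intervalIntegrable; fun_prop)
    (by apply Continuous.intervalIntegrable; fun_prop),
    intervalIntegral.integral_const_mul, intervalIntegral.integral_const_mul,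
    hcos (n + k) (by omega)]
  split_ifs with h
  · subst h; simp
  · rw [hcos (n - k) (by omega)]; simp

lemma aux_im (f : ℂ → ℂ) (a : ℕ → ℝ) (hf : IsTypicallyReal f a) (r : ℝ) (h0 : 0 < r) (h1 : r < 1)
    (t : ℝ) : HasSum (fun n : ℕ => a n * r ^ n * Real.sin (n * t))
      (f (r * Complex.exp (t * Complex.I))).im ∧
      0 ≤ Real.sin t * (f (r * Complex.exp (t * Complex.I))).im := by
  obtain ⟨_, _, _, hs, hp⟩ := hf
  have hz : (r * Complex.exp (t * Complex.I) : ℂ) ∈ Metric.ball (0:ℂ) 1 := by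
    simp [Complex.norm_exp_ofReal_mul_I, abs_of_pos h0, h1]
  constructor
  · have := Complex.hasSum_im (hs _ hz)
    convert this using 2 with n
    rw [mul_pow, ← Complex.exp_nat_mul, ← mul_assoc, ← mul_assoc, ← Complex.ofReal_pow,
      ← Complex.ofReal_mul, Complex.im_ofReal_mul]
    congr 1
    rw [← Complex.exp_ofReal_mul_I_im]
    push_cast; rfl
  · have := hp _ hz
    rw [Complex.im_ofReal_mul, Complex.exp_ofReal_mul_I_im, mul_assoc] at this
    exact nonneg_of_mul_nonneg_right this h0

open MeasureTheory in
lemma aux_coef (f : ℂ → ℂ) (a : ℕ → ℝ) (hf : IsTypicallyReal f a) (r : ℝ) (h0 : 0 < r) (h1 : r < 1)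
    (k : ℕ) (hk : 1 ≤ k) :
    ∫ t in (0:ℝ)..(2 * Real.pi), (f (r * Complex.exp (t * Complex.I))).im * Real.sin (k * t)
      = Real.pi * (a k * r ^ k) := by
  have hsum : Summable (fun n : ℕ => |a n * r ^ n|) := by
    have := (hf.2.2.2.1 (r : ℂ) (by simp [abs_of_pos h0, h1])).summable.norm
    simpa [abs_mul] using this
  have H := intervalIntegral.hasSum_integral_of_dominated_convergence
    (μ := volume) (a := 0) (b := 2 * Real.pi)
    (F := fun (n : ℕ) (t : ℝ) => a n * r ^ n * Real.sin (n * t) * Real.sin (k * t))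
    (f := fun t : ℝ => (f (r * Complex.exp (t * Complex.I))).im * Real.sin (k * t))
    (fun n _ => |a n * r ^ n|)
    (fun n => by apply Continuous.aestronglyMeasurable; fun_prop)
    (fun n => Filter.Eventually.of_forall fun t _ => by
      rw [Real.norm_eq_abs, abs_mul, abs_mul (a n * r ^ n)]
      have h2 := Real.abs_sin_le_one (n * t)
      have h3 := Real.abs_sin_le_one (k * t)
      have h4 := mul_le_mul h2 h3 (abs_nonneg _) zero_le_one
      rw [mul_assoc]
      nlinarith [abs_nonneg (a n * r ^ n)])
    (Filter.Eventually.of_forall fun t _ => hsum)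
    (by simp)
    (Filter.Eventually.of_forall fun t _ => (aux_im f a hf r h0 h1 t).1.mul_right _)
  have H2 : HasSum (fun n : ℕ => if n = k then Real.pi * (a k * r ^ k) else 0)
      (Real.pi * (a k * r ^ k)) := hasSum_ite_eq k _
  refine H.unique ?_
  refine Eq.mp (congrArg (fun u => HasSum u _) (funext fun n => ?_)) H2
  symm
  simp_rw [mul_assoc (a n * r ^ n)]
  rw [intervalIntegral.integral_const_mul, aux_int n k hk]
  split_ifs with h
  · subst h; ring
  · simp

lemma aux_cont (f : ℂ → ℂ) (a : ℕ → ℝ) (hf : IsTypicallyReal f a) (r : ℝ) (h0 : 0 < r) (h1 : r < 1) :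
    Continuous (fun t : ℝ => (f (r * Complex.exp (t * Complex.I))).im) := by
  refine Complex.continuous_im.comp ?_
  refine hf.1.continuousOn.comp_continuous (by fun_prop) ?_
  intro t
  simp [Complex.norm_exp_ofReal_mul_I, abs_of_pos h0, h1]

lemma aux_pos (f : ℂ → ℂ) (a : ℕ → ℝ) (hf : IsTypicallyReal f a) (p q s : ℝ)
    (h : ∀ c : ℝ, -1 ≤ c → c ≤ 1 → 0 ≤ p + q * (4 * c ^ 2 - 1) + s * (8 * c ^ 3 - 4 * c)) :
    0 ≤ p + q * a 3 + s * a 4 := by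
  have key : ∀ r : ℝ, 0 < r → r < 1 → 0 ≤ p * r + q * (a 3 * r ^ 3) + s * (a 4 * r ^ 4) := by
    intro r h0 h1
    have hc := aux_cont f a hf r h0 h1
    have e1 := aux_coef f a hf r h0 h1 1 le_rfl
    have e3 := aux_coef f a hf r h0 h1 3 (by norm_num)
    have e4 := aux_coef f a hf r h0 h1 4 (by norm_num)
    set g : ℝ → ℝ := fun t : ℝ => (f (r * Complex.exp (t * Complex.I))).im with hg
    have hI : ∀ k : ℕ, IntervalIntegrable (fun t => g t * Real.sin (k * t)) MeasureTheory.volume 0 (2 * Real.pi) := by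
      intro k
      apply Continuous.intervalIntegrable
      fun_prop
    have E : ∫ t in (0:ℝ)..(2 * Real.pi), (p * (g t * Real.sin ((1:ℕ) * t)) +
        q * (g t * Real.sin ((3:ℕ) * t)) + s * (g t * Real.sin ((4:ℕ) * t))) =
        Real.pi * (p * r + q * (a 3 * r ^ 3) + s * (a 4 * r ^ 4)) := by
      rw [intervalIntegral.integral_add (((hI 1).const_mul p).add ((hI 3).const_mul q))
        ((hI 4).const_mul s),
        intervalIntegral.integral_add ((hI 1).const_mul p) ((hI 3).const_mul q),
        intervalIntegral.integral_const_mul, intervalIntegral.integral_const_mul,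
        intervalIntegral.integral_const_mul, e1, e3, e4, hf.2.2.1]
      ring
    have P : 0 ≤ ∫ t in (0:ℝ)..(2 * Real.pi), (p * (g t * Real.sin ((1:ℕ) * t)) +
        q * (g t * Real.sin ((3:ℕ) * t)) + s * (g t * Real.sin ((4:ℕ) * t))) := by
      apply intervalIntegral.integral_nonneg_of_forall (by positivity)
      intro t
      have hp := (aux_im f a hf r h0 h1 t).2
      have hh := h (Real.cos t) (Real.neg_one_le_cos t) (Real.cos_le_one t)
      have s3 : Real.sin ((3:ℕ) * t) = Real.sin t * (4 * Real.cos t ^ 2 - 1) := by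
        push_cast
        rw [Real.sin_three_mul]
        have := Real.sin_sq_add_cos_sq t
        linear_combination (-4 * Real.sin t) * this
      have s4 : Real.sin ((4:ℕ) * t) = Real.sin t * (8 * Real.cos t ^ 3 - 4 * Real.cos t) := by
        push_cast
        rw [show (4:ℝ) * t = 2 * (2 * t) by ring, Real.sin_two_mul, Real.sin_two_mul,
          Real.cos_two_mul]
        ring
      rw [s3, s4]
      have := mul_nonneg hp hh
      change 0 ≤ Real.sin t * g t * _ at this
      rw [Nat.cast_one, one_mul]
      linarith
    rw [E] at P
    exact nonneg_of_mul_nonneg_right P Real.pi_pos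
  have hT : Filter.Tendsto (fun r : ℝ => p * r + q * (a 3 * r ^ 3) + s * (a 4 * r ^ 4))
      (nhdsWithin 1 (Set.Iio 1)) (nhds (p * 1 + q * (a 3 * 1 ^ 3) + s * (a 4 * 1 ^ 4))) := by
    apply Filter.Tendsto.mono_left _ nhdsWithin_le_nhds
    apply Continuous.tendsto
    fun_prop
  have := ge_of_tendsto hT (b := 0) (by
    filter_upwards [Ioo_mem_nhdsLT (show (0:ℝ) < 1 by norm_num)] with r hr
    exact key r hr.1 hr.2)
  simpa using this

lemma koebe_im (z : ℂ) (hz : ‖z‖ < 1) : 0 ≤ z.im * (z / (1 - z) ^ 2).im := by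
  have h2 : z.re ^ 2 + z.im ^ 2 ≤ 1 := by
    have := Complex.sq_norm z
    rw [Complex.normSq_apply] at this
    nlinarith [norm_nonneg z]
  have e : z / (1 - z) ^ 2 = ((Complex.normSq ((1 - z) ^ 2))⁻¹ : ℝ) *
      (z * (starRingEnd ℂ) ((1 - z) ^ 2)) := by
    rw [div_eq_mul_inv, Complex.inv_def]; push_cast; ring
  rw [e, Complex.im_ofReal_mul]
  have e2 : (z * (starRingEnd ℂ) ((1 - z) ^ 2)).im = z.im * (1 - (z.re ^ 2 + z.im ^ 2)) := by
    simp [pow_two]; ring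
  rw [e2]
  have := inv_nonneg.2 (Complex.normSq_nonneg ((1 - z) ^ 2))
  have h3 := mul_nonneg this (mul_nonneg (mul_self_nonneg z.im) (sub_nonneg.2 h2))
  linarith

lemma koebe_diff : DifferentiableOn ℂ (fun z : ℂ => z / (1 - z) ^ 2) (Metric.ball (0:ℂ) 1) := by
  intro z hz
  have hne : (1 - z) ^ 2 ≠ 0 := by
    apply pow_ne_zero
    intro h
    have : z = 1 := (sub_eq_zero.1 h).symm
    simp [this] at hz
  apply DifferentiableAt.differentiableWithinAt
  fun_prop (disch := assumption)

lemma koebe_sum (z : ℂ) (hz : ‖z‖ < 1) :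
    HasSum (fun n : ℕ => (n : ℂ) * z ^ n) (z / (1 - z) ^ 2) :=
  hasSum_coe_mul_geometric_of_norm_lt_one hz

theorem stmt_17 :
    (∀ (f : ℂ → ℂ) (a : ℕ → ℝ), IsTypicallyReal f a →
      -7 ≤ a 3 ^ 2 - a 4 ^ 2 ∧ a 3 ^ 2 - a 4 ^ 2 ≤ 9) ∧
    (∃ (f : ℂ → ℂ) (a : ℕ → ℝ), IsTypicallyReal f a ∧
      a 3 ^ 2 - a 4 ^ 2 = -7) ∧
    (∃ (f : ℂ → ℂ) (a : ℕ → ℝ), IsTypicallyReal f a ∧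
      a 3 ^ 2 - a 4 ^ 2 = 9) := by
  refine ⟨?_, ?_, ?_⟩
  · intro f a hf
    have h1 := aux_pos f a hf 3 (-1) 0 (by intro c h1 h2; nlinarith)
    have h2 := aux_pos f a hf 1 1 0 (by intro c h1 h2; nlinarith)
    have h3 := aux_pos f a hf 7 3 (-4) (by
      intro c h1 h2
      have : 0 ≤ (1 - c) * (16 * c ^ 2 + 10 * c + 2) :=
        mul_nonneg (by linarith) (by nlinarith [sq_nonneg (16 * c + 5)])
      nlinarith)
    have h4 := aux_pos f a hf 7 3 4 (by
      intro c h1 h2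
      have : 0 ≤ (1 + c) * (16 * c ^ 2 - 10 * c + 2) :=
        mul_nonneg (by linarith) (by nlinarith [sq_nonneg (16 * c - 5)])
      nlinarith)
    constructor
    · nlinarith [sq_nonneg (a 3 - 3), mul_nonneg h3 h4]
    · nlinarith [sq_nonneg (a 4)]
  · refine ⟨fun z => z / (1 - z) ^ 2, fun n => n, ⟨koebe_diff, by simp, by simp, ?_, ?_⟩, by norm_num⟩
    · intro z hz
      simpa using koebe_sum z (by simpa using hz)
    · intro z hz
      exact koebe_im z (by simpa using hz)
  · refine ⟨fun z => (z / (1 - z) ^ 2 - (-z) / (1 - (-z)) ^ 2) / 2,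
      fun n => (n - (-1) ^ n * n) / 2, ⟨?_, by simp, by norm_num, ?_, ?_⟩, by norm_num⟩
    · refine (koebe_diff.sub ?_).div_const 2
      exact koebe_diff.comp (f := fun z : ℂ => -z) differentiableOn_id.neg
        (by intro z hz; simpa using hz)
    · intro z hz
      have hz' : ‖z‖ < 1 := by simpa using hz
      refine Eq.mp (congrArg (fun u => HasSum u _) (funext fun n => ?_))
        (((koebe_sum z hz').sub (koebe_sum (-z) (by simpa using hz'))).div_const 2)
      rw [neg_pow z n]
      push_cast
      ring
    · intro z hz
      have hz' : ‖z‖ < 1 := by simpa using hz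
      have h1 := koebe_im z hz'
      have h2 := koebe_im (-z) (by simpa using hz')
      rw [Complex.neg_im] at h2
      have e : ∀ w : ℂ, (w / 2).im = w.im / 2 := by intro w; simp
      simp only [e, Complex.sub_im]
      linarith
end

section
/- If f is in the class T of typically real functions on the unit disk with Taylor expansion f(z) = z + ∑_{k≥2} a_k z^k (so that all coefficients a_k are real), then −8 ≤ T_3(1) = 1 − 2a_2² + 2a_2² a_3 − a_3² ≤ 8; moreover both bounds are attained within T: the maximum 8 is attained by the Koebe-type function k(z,−1) = z/(1+z)², and the minimum −8 is attained by f(z) = (1/2)·z/(1−z)² + (1/2)·z/(1+z)². -/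
open MeasureTheory in
theorem tr_cos_int (m : ℤ) : ∫ t in (0:ℝ)..(2 * Real.pi), Real.cos (m * t) =
    if m = 0 then 2 * Real.pi else 0 := by
  split_ifs with h
  · simp [h]
  · have hm : (m : ℝ) ≠ 0 := by exact_mod_cast h
    rw [intervalIntegral.integral_comp_mul_left _ hm]
    have : Real.sin ((m : ℝ) * (2 * Real.pi)) = 0 := by
      have := Real.sin_int_mul_pi (m * 2)
      push_cast at this
      rw [← mul_assoc]; exact this
    simp [this]

theorem tr_sin_int (n k : ℕ) (hk : k ≠ 0) :
    ∫ t in (0:ℝ)..(2 * Real.pi), Real.sin (n * t) * Real.sin (k * t) =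
    if n = k then Real.pi else 0 := by
  have h : ∀ t : ℝ, Real.sin (n * t) * Real.sin (k * t) =
      (1/2) * Real.cos (((n - k : ℤ) : ℝ) * t) - (1/2) * Real.cos (((n + k : ℤ) : ℝ) * t) := by
    intro t
    push_cast
    rw [sub_mul, add_mul, Real.cos_sub, Real.cos_add]; ring
  simp_rw [h]
  rw [intervalIntegral.integral_sub, intervalIntegral.integral_const_mul,
    intervalIntegral.integral_const_mul, tr_cos_int, tr_cos_int]
  · have h1 : ((n : ℤ) + k) ≠ 0 := by omega
    by_cases hnk : n = k
    · subst hnk; rw [if_pos (by omega), if_neg h1, if_pos rfl]; ring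
    · rw [if_neg (by omega), if_neg h1, if_neg hnk]; ring
  · exact Continuous.intervalIntegrable (by fun_prop) _ _
  · exact Continuous.intervalIntegrable (by fun_prop) _ _

theorem tr_im_hasSum {f : ℂ → ℂ} {a : ℕ → ℝ} (hf : IsTypicallyReal f a) {r : ℝ} (h0 : 0 < r)
    (h1 : r < 1) (t : ℝ) :
    HasSum (fun n : ℕ => a n * r ^ n * Real.sin (n * t)) (f (r * Complex.exp (t * Complex.I))).im := by
  obtain ⟨_, _, _, hs, _⟩ := hf
  have hz : ((r:ℂ) * Complex.exp (t * Complex.I)) ∈ Metric.ball (0:ℂ) 1 := by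
    simp [Complex.norm_exp_ofReal_mul_I, abs_of_pos h0, h1]
  have := Complex.hasSum_im (hs _ hz)
  convert this using 2 with n
  rw [mul_pow, ← Complex.exp_nat_mul, ← Complex.ofReal_pow, ← mul_assoc, ← Complex.ofReal_mul,
    Complex.im_ofReal_mul, ← mul_assoc]
  congr 1
  rw [← Complex.exp_ofReal_mul_I_im]
  push_cast; rfl

theorem tr_pos {f : ℂ → ℂ} {a : ℕ → ℝ} (hf : IsTypicallyReal f a) {r : ℝ} (h0 : 0 < r)
    (h1 : r < 1) (A B C : ℝ)
    (hw : ∀ t : ℝ, ∃ p : ℝ, 0 ≤ p ∧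
      A * Real.sin t + B * Real.sin (2 * t) + C * Real.sin (3 * t) = Real.sin t * p) :
    0 ≤ A * (a 1 * r) + B * (a 2 * r ^ 2) + C * (a 3 * r ^ 3) := by
  set w : ℝ → ℝ := fun t => A * Real.sin ((1:ℕ) * t) + B * Real.sin ((2:ℕ) * t)
    + C * Real.sin ((3:ℕ) * t) with hwdef
  have hwb : ∀ t, |w t| ≤ |A| + |B| + |C| := by
    intro t
    have e : ∀ (x y : ℝ), |x * Real.sin y| ≤ |x| := fun x y => by
      rw [abs_mul]; exact mul_le_of_le_one_right (abs_nonneg _) (Real.abs_sin_le_one _)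
    exact (abs_add_three _ _ _).trans (add_le_add (add_le_add (e _ _) (e _ _)) (e _ _))
  have hsum : Summable (fun n : ℕ => |a n * r ^ n|) := by
    have hz : (r:ℂ) ∈ Metric.ball (0:ℂ) 1 := by simp [abs_of_pos h0, h1]
    have := (hf.2.2.2.1 _ hz).summable.norm
    refine this.congr fun n => ?_
    rw [← Complex.ofReal_pow, ← Complex.ofReal_mul, Complex.norm_real, Real.norm_eq_abs]
  have hF := intervalIntegral.hasSum_integral_of_dominated_convergence
    (μ := MeasureTheory.volume) (a := 0) (b := 2 * Real.pi)
    (F := fun (n : ℕ) t => a n * r ^ n * Real.sin (n * t) * w t)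
    (f := fun t => (f (r * Complex.exp (t * Complex.I))).im * w t)
    (fun n _ => |a n * r ^ n| * (|A| + |B| + |C|))
    (fun n => Continuous.aestronglyMeasurable (by fun_prop))
    (fun n => Filter.Eventually.of_forall fun t _ => by
      rw [Real.norm_eq_abs, abs_mul, abs_mul]
      exact mul_le_mul (mul_le_of_le_one_right (abs_nonneg _) (Real.abs_sin_le_one _)) (hwb t)
        (abs_nonneg _) (abs_nonneg _))
    (Filter.Eventually.of_forall fun t _ => hsum.mul_right _)
    (by simp)
    (Filter.Eventually.of_forall fun t _ => (tr_im_hasSum hf h0 h1 t).mul_right _)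
  have hI : 0 ≤ ∫ t in (0:ℝ)..(2 * Real.pi), (f (r * Complex.exp (t * Complex.I))).im * w t := by
    apply intervalIntegral.integral_nonneg (by positivity)
    intro t _
    obtain ⟨p, hp, he⟩ := hw t
    have hz : ((r:ℂ) * Complex.exp (t * Complex.I)) ∈ Metric.ball (0:ℂ) 1 := by
      simp [Complex.norm_exp_ofReal_mul_I, abs_of_pos h0, h1]
    have h := hf.2.2.2.2 _ hz
    rw [Complex.im_ofReal_mul, Complex.exp_ofReal_mul_I_im] at h
    have h' : 0 ≤ Real.sin t * (f (r * Complex.exp (t * Complex.I))).im := by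
      rw [mul_assoc] at h; exact nonneg_of_mul_nonneg_right h h0
    have : w t = Real.sin t * p := by rw [← he]; simp [hwdef]
    rw [this, ← mul_assoc, mul_comm _ (Real.sin t)]
    exact mul_nonneg h' hp
  have hterm : ∀ n : ℕ, ∫ t in (0:ℝ)..(2 * Real.pi), a n * r ^ n * Real.sin (n * t) * w t =
      a n * r ^ n * (A * (if n = 1 then Real.pi else 0) + B * (if n = 2 then Real.pi else 0)
        + C * (if n = 3 then Real.pi else 0)) := by
    intro n
    rw [← tr_sin_int n 1 (by norm_num), ← tr_sin_int n 2 (by norm_num),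
      ← tr_sin_int n 3 (by norm_num), ← intervalIntegral.integral_const_mul,
      ← intervalIntegral.integral_const_mul, ← intervalIntegral.integral_const_mul,
      ← intervalIntegral.integral_add, ← intervalIntegral.integral_add,
      ← intervalIntegral.integral_const_mul]
    · congr 1; ext t; simp only [hwdef]; ring
    all_goals exact Continuous.intervalIntegrable (by fun_prop) _ _
  have hfin := hasSum_sum_of_ne_finset_zero (L := SummationFilter.unconditional ℕ) (s := Finset.range 4)
    (f := fun n : ℕ => ∫ t in (0:ℝ)..(2 * Real.pi), a n * r ^ n * Real.sin (n * t) * w t) (by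
      intro n hn
      simp only [Finset.mem_range, not_lt] at hn
      rw [hterm, if_neg (by omega), if_neg (by omega), if_neg (by omega)]; ring)
  rw [hF.unique hfin] at hI
  simp only [hterm, Finset.sum_range_succ, Finset.sum_range_zero] at hI
  norm_num at hI
  refine nonneg_of_mul_nonneg_left (b := Real.pi) ?_ Real.pi_pos
  linarith

theorem tr_pos_one {f : ℂ → ℂ} {a : ℕ → ℝ} (hf : IsTypicallyReal f a) (A B C : ℝ)
    (hw : ∀ t : ℝ, ∃ p : ℝ, 0 ≤ p ∧
      A * Real.sin t + B * Real.sin (2 * t) + C * Real.sin (3 * t) = Real.sin t * p) :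
    0 ≤ A + B * a 2 + C * a 3 := by
  have hc : Filter.Tendsto (fun r : ℝ => A * (a 1 * r) + B * (a 2 * r ^ 2) + C * (a 3 * r ^ 3))
      (nhdsWithin 1 (Set.Iio 1)) (nhds (A * (a 1 * 1) + B * (a 2 * 1 ^ 2) + C * (a 3 * 1 ^ 3))) :=
    (Continuous.tendsto (by fun_prop) 1).mono_left nhdsWithin_le_nhds
  have := ge_of_tendsto hc (b := 0) (by
    filter_upwards [Ioo_mem_nhdsLT (show (0:ℝ) < 1 by norm_num)] with r hr
    exact tr_pos hf hr.1 hr.2 A B C hw)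
  rw [hf.2.2.1] at this
  linarith

theorem tr_koebe_im (s : ℝ) (hs : s ^ 2 = 1) (z : ℂ) (hz : z ∈ Metric.ball (0:ℂ) 1) :
    0 ≤ z.im * (z / (1 + s * z) ^ 2).im := by
  have hz' : z.re ^ 2 + z.im ^ 2 < 1 := by
    have h : ‖z‖ < 1 := by simpa using hz
    have := Complex.sq_norm z
    rw [Complex.normSq_apply] at this
    nlinarith [norm_nonneg z]
  have hc : 0 ≤ (Complex.normSq ((1 + s * z) ^ 2))⁻¹ := inv_nonneg.2 (Complex.normSq_nonneg _)
  rw [div_eq_mul_inv, Complex.inv_def]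
  set c := (Complex.normSq ((1 + s * z) ^ 2))⁻¹
  have : (z * ((starRingEnd ℂ) ((1 + s * z) ^ 2) * (c:ℂ))).im =
      c * (z.im * (1 - s ^ 2 * (z.re ^ 2 + z.im ^ 2))) := by
    simp [pow_two]
    ring
  rw [this, hs]
  have : 0 ≤ c * z.im ^ 2 * (1 - (z.re ^ 2 + z.im ^ 2)) :=
    mul_nonneg (mul_nonneg hc (sq_nonneg _)) (by linarith)
  linarith

theorem tr_ne {z : ℂ} (hz : z ∈ Metric.ball (0:ℂ) 1) : 1 + z ≠ 0 ∧ 1 - z ≠ 0 := by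
  have h : ‖z‖ < 1 := by simpa using hz
  constructor
  · intro h'
    have : z = -1 := by linear_combination h'
    simp [this] at h
  · intro h'
    have : z = 1 := by linear_combination -h'
    simp [this] at h

theorem stmt_18 :
    (∀ (f : ℂ → ℂ) (a : ℕ → ℝ), IsTypicallyReal f a →
      -8 ≤ 1 - 2 * a 2 ^ 2 + 2 * a 2 ^ 2 * a 3 - a 3 ^ 2 ∧
      1 - 2 * a 2 ^ 2 + 2 * a 2 ^ 2 * a 3 - a 3 ^ 2 ≤ 8) ∧
    (∃ a : ℕ → ℝ,
      IsTypicallyReal (fun z : ℂ => z / (1 + z) ^ 2) a ∧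
      1 - 2 * a 2 ^ 2 + 2 * a 2 ^ 2 * a 3 - a 3 ^ 2 = 8) ∧
    (∃ a : ℕ → ℝ,
      IsTypicallyReal
        (fun z : ℂ => (1 / 2) * (z / (1 - z) ^ 2) + (1 / 2) * (z / (1 + z) ^ 2)) a ∧
      1 - 2 * a 2 ^ 2 + 2 * a 2 ^ 2 * a 3 - a 3 ^ 2 = -8) := by
  have hK1 : ∀ z ∈ Metric.ball (0:ℂ) 1,
      HasSum (fun n : ℕ => (n : ℂ) * z ^ n) (z / (1 - z) ^ 2) := fun z hz =>
    hasSum_coe_mul_geometric_of_norm_lt_one (by simpa using hz)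
  have hK2 : ∀ z ∈ Metric.ball (0:ℂ) 1,
      HasSum (fun n : ℕ => -((n : ℂ) * (-1) ^ n) * z ^ n) (z / (1 + z) ^ 2) := fun z hz => by
    have := (hK1 (-z) (by simpa using hz)).neg
    have e1 : (fun n : ℕ => -((n : ℂ) * (-1) ^ n) * z ^ n) =
        fun n : ℕ => -((n : ℂ) * (-z) ^ n) := by
      funext n; rw [neg_pow z]; ring
    have e2 : z / (1 + z) ^ 2 = -(-z / (1 - -z) ^ 2) := by rw [sub_neg_eq_add]; ring
    rw [e1, e2]; exact this
  refine ⟨fun f a hf => ?_, ⟨fun n => -((n:ℝ) * (-1) ^ n), ⟨?_, ?_, ?_, ?_, ?_⟩, ?_⟩,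
    ⟨fun n => ((n:ℝ) - (n:ℝ) * (-1) ^ n) / 2, ⟨?_, ?_, ?_, ?_, ?_⟩, ?_⟩⟩
  · have h1 : 0 ≤ 3 + 0 * a 2 + (-1) * a 3 := tr_pos_one hf _ _ _ fun t =>
      ⟨4 * Real.sin t ^ 2, by positivity, by rw [Real.sin_three_mul]; ring⟩
    have h2 : 0 ≤ (1 + a 2 ^ 2) + (-2 * a 2) * a 2 + 1 * a 3 := tr_pos_one hf _ _ _ fun t =>
      ⟨(2 * Real.cos t - a 2) ^ 2, by positivity, by
        rw [Real.sin_three_mul, Real.sin_two_mul]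
        linear_combination (-4 * Real.sin t) * Real.sin_sq_add_cos_sq t⟩
    generalize a 2 = x at *
    generalize a 3 = y at *
    have hx := sq_nonneg x
    have h3 : x ^ 2 ≤ 1 + y := by nlinarith
    clear h2
    generalize x ^ 2 = u at *
    have h4 : y ≤ 3 := by linarith
    constructor <;> rcases le_total y 1 with h | h <;> nlinarith
  · intro z hz
    have h2 : DifferentiableAt ℂ (fun z : ℂ => z / (1 + z) ^ 2) z :=
      DifferentiableAt.div (by fun_prop) (by fun_prop) (pow_ne_zero _ (tr_ne hz).1)
    exact h2.differentiableWithinAt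
  · simp
  · simp
  · intro z hz
    simpa using hK2 z hz
  · intro z hz
    simpa using tr_koebe_im 1 (by norm_num) z hz
  · norm_num
  · intro z hz
    have h1 : DifferentiableAt ℂ (fun z : ℂ => z / (1 - z) ^ 2) z :=
      DifferentiableAt.div (by fun_prop) (by fun_prop) (pow_ne_zero _ (tr_ne hz).2)
    have h2 : DifferentiableAt ℂ (fun z : ℂ => z / (1 + z) ^ 2) z :=
      DifferentiableAt.div (by fun_prop) (by fun_prop) (pow_ne_zero _ (tr_ne hz).1)
    exact ((h1.const_mul _).add (h2.const_mul _)).differentiableWithinAt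
  · simp
  · norm_num
  · intro z hz
    have := ((hK1 z hz).mul_left (1/2)).add ((hK2 z hz).mul_left (1/2))
    refine this.congr_fun ?_
    intro n; push_cast; ring
  · intro z hz
    have h1 := tr_koebe_im 1 (by norm_num) z hz
    have h2 := tr_koebe_im (-1) (by norm_num) z hz
    have e : ((1 / 2 : ℂ)) = ((1 / 2 : ℝ) : ℂ) := by push_cast; rfl
    simp only [e, Complex.add_im, Complex.im_ofReal_mul]
    simp only [Complex.ofReal_one, one_mul, Complex.ofReal_neg, neg_mul, ← sub_eq_add_neg] at h1 h2
    linarith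
  · norm_num
end
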